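/- arXiv:1110.1249 — 2 statements merged into one kernel-verified Lean document; each statement's English description precedes it below -/
import Mathlib

section
/- There exist positive constants C and c such that for any functions k = k(n) ≥ 3 and r = r(n) ≥ 2 satisfying r^{k-1}/k ≥ C and r^{k-1} = o(n), the following holds: if p = p(n) ≤ c · (r^{k-1}/k²) · n/C(n,k), then P(H(n,k,p) is r-colorable) → 1 as n → ∞. -/
open Finset Filter

open scoped Classical

namespace HG

/-- A finset `e` is monochromatic under the coloring `c`. -/
def Monochromatic {V α : Type*} (c : V → α) (e : Finset V) : Prop :=
  ∀ v ∈ e, ∀ w ∈ e, c v = c w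

/-- The hypergraph with edge set `E` admits a proper coloring with `r` colors. -/
def RColorable {V : Type*} (r : ℕ) (E : Finset (Finset V)) : Prop :=
  ∃ c : V → Fin r, ∀ e ∈ E, ¬ Monochromatic c e

/-- The hypergraph with edge set `E` is `r`-choosable: for every assignment of
color lists of size `r` there is a proper coloring from the lists. -/
def RChoosable {V : Type*} (r : ℕ) (E : Finset (Finset V)) : Prop :=
  ∀ L : V → Finset ℕ, (∀ v, (L v).card = r) →
    ∃ c : V → ℕ, (∀ v, c v ∈ L v) ∧ ∀ e ∈ E, ¬ Monochromatic c e

/-- Probability that the binomial random hypergraph `H(n,k,p)` (each of the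
`C(n,k)` possible `k`-element edges present independently with probability `p`)
satisfies the property `P` of its edge set. -/
noncomputable def hyperProb (n k : ℕ) (p : ℝ)
    (P : Finset (Finset (Fin n)) → Prop) : ℝ :=
  ∑ E ∈ ((Finset.univ : Finset (Fin n)).powersetCard k).powerset,
    if P E then
      p ^ E.card *
        (1 - p) ^ (((Finset.univ : Finset (Fin n)).powersetCard k).card - E.card)
    else 0

/-- Maximum vertex degree of the hypergraph with edge set `E`. -/
def maxDegree {V : Type*} [DecidableEq V] (E : Finset (Finset V)) : ℕ :=
  (E.biUnion id).sup fun v => (E.filter fun e => v ∈ e).card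

/-- Three distinct edges forming a 3-cycle (triangle). -/
def IsTriangle {V : Type*} [DecidableEq V] (e f h : Finset V) : Prop :=
  e ≠ f ∧ e ≠ h ∧ f ≠ h ∧ ((e ∩ f) \ h).Nonempty ∧ ((e ∩ h) \ f).Nonempty ∧
    ((f ∩ h) \ e).Nonempty

/-- A hypergraph is 2-simple if any two distinct edges share at most 2 vertices. -/
def TwoSimple {V : Type*} [DecidableEq V] (E : Finset (Finset V)) : Prop :=
  ∀ e ∈ E, ∀ f ∈ E, e ≠ f → (e ∩ f).card ≤ 2

/-- The number of 3-cycles of the hypergraph `E` containing the edge `e`. -/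
noncomputable def triCount {V : Type*} [DecidableEq V]
    (E : Finset (Finset V)) (e : Finset V) : ℕ :=
  ((E.powersetCard 2).filter fun s =>
    ∃ f ∈ s, ∃ h ∈ s, f ≠ h ∧ IsTriangle e f h).card

/-- The function `φ(k) = 4⌊√(ln k / ln (2 ln k))⌋⁻¹`. -/
noncomputable def phi (k : ℕ) : ℝ :=
  4 * ((⌊Real.sqrt (Real.log k / Real.log (2 * Real.log k))⌋₊ : ℝ))⁻¹

end HG


/-- Symmetric local lemma in counting form. -/
theorem exists_avoiding {Ω ι : Type*} [Fintype Ω] [Nonempty Ω] (A : ι → Ω → Prop)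
    (nbr : ι → ι → Prop) (K : ℕ) (hK : 2 < K) (F₀ : Finset ι)
    (hind : ∀ e ∈ F₀, ∀ F ⊆ F₀, (∀ f ∈ F, ¬ nbr e f) →
      K * #{ω | A e ω ∧ ∀ f ∈ F, ¬ A f ω} ≤ #{ω | ∀ f ∈ F, ¬ A f ω})
    (hdeg : ∀ e ∈ F₀, 4 * #{f ∈ F₀ | nbr e f} ≤ K) :
    ∃ ω, ∀ f ∈ F₀, ¬ A f ω := by
  have key : ∀ m, ∀ F ⊆ F₀, #F = m → ∀ e ∈ F₀,
      K * #{ω | A e ω ∧ ∀ f ∈ F, ¬ A f ω} ≤ 2 * #{ω | ∀ f ∈ F, ¬ A f ω} := by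
    intro m
    induction m using Nat.strong_induction_on with
    | _ m ih =>
      intro F hF hFm e he
      set G := F.filter fun f => ¬ nbr e f with hG
      set N := F.filter fun f => nbr e f with hN
      have hGF : G ⊆ F := filter_subset _ _
      have h1 : #{ω | A e ω ∧ ∀ f ∈ F, ¬ A f ω} ≤ #{ω | A e ω ∧ ∀ f ∈ G, ¬ A f ω} := by
        apply card_le_card
        intro ω hω
        simp only [mem_filter, mem_univ, true_and] at hω ⊢
        exact ⟨hω.1, fun f hf => hω.2 f (hGF hf)⟩
      have h2 := hind e he G (hGF.trans hF) (fun f hf => (mem_filter.1 hf).2)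
      have h3 : #{ω | ∀ f ∈ G, ¬ A f ω} ≤ #{ω | ∀ f ∈ F, ¬ A f ω} +
          ∑ f ∈ N, #{ω | A f ω ∧ ∀ f ∈ G, ¬ A f ω} := by
        refine le_trans ?_ (Nat.add_le_add_left card_biUnion_le _)
        refine le_trans (card_le_card ?_) (card_union_le _ _)
        intro ω hω
        simp only [mem_filter, mem_univ, true_and, mem_union, mem_biUnion] at hω ⊢
        by_contra hcon
        push Not at hcon
        obtain ⟨⟨f, hf, hAf⟩, hcon⟩ := hcon
        by_cases hn : nbr e f
        · obtain ⟨g, hg, hAg⟩ := hcon f (mem_filter.2 ⟨hf, hn⟩) hAf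
          exact hω g hg hAg
        · exact hω f (mem_filter.2 ⟨hf, hn⟩) hAf
      have h4 : K * ∑ f ∈ N, #{ω | A f ω ∧ ∀ f ∈ G, ¬ A f ω} ≤
          #N * (2 * #{ω | ∀ f ∈ G, ¬ A f ω}) := by
        rw [mul_sum]
        apply sum_le_card_nsmul
        intro f hf
        have hlt : #G < m := by
          rw [← hFm]
          apply card_lt_card
          refine ⟨hGF, fun h => ?_⟩
          exact (mem_filter.1 (h (mem_filter.1 hf).1)).2 (mem_filter.1 hf).2
        exact ih _ hlt G (hGF.trans hF) rfl f (hF (mem_filter.1 hf).1)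
      have h5 : 4 * #N ≤ K :=
        le_trans (Nat.mul_le_mul_left _ (card_le_card (filter_subset_filter _ hF))) (hdeg e he)
      set a := #{ω | ∀ f ∈ G, ¬ A f ω}
      set b := #{ω | ∀ f ∈ F, ¬ A f ω}
      set s := ∑ f ∈ N, #{ω | A f ω ∧ ∀ f ∈ G, ¬ A f ω}
      have h6 : a ≤ 2 * b := by
        have : K * a ≤ K * (2 * b) := by nlinarith
        exact Nat.le_of_mul_le_mul_left this (by omega)
      calc _ ≤ K * #{ω | A e ω ∧ ∀ f ∈ G, ¬ A f ω} := Nat.mul_le_mul_left _ h1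
        _ ≤ a := h2
        _ ≤ 2 * b := h6
  have pos : ∀ F ⊆ F₀, 0 < #{ω | ∀ f ∈ F, ¬ A f ω} := by
    intro F
    induction F using Finset.induction_on with
    | empty => intro _; simp [Fintype.card_pos]
    | insert e F _ ih =>
      intro h
      have hF := (subset_insert e F).trans h
      have h1 := ih hF
      have h2 := key _ F hF rfl e (h (mem_insert_self e F))
      have h3 : #{ω | ∀ f ∈ F, ¬ A f ω} ≤ #{ω | ∀ f ∈ insert e F, ¬ A f ω} +
          #{ω | A e ω ∧ ∀ f ∈ F, ¬ A f ω} := by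
        refine le_trans (card_le_card ?_) (card_union_le _ _)
        intro ω hω
        simp only [mem_filter, mem_univ, true_and, mem_union, mem_insert, forall_eq_or_imp] at hω ⊢
        tauto
      by_contra hcon
      nlinarith
  obtain ⟨ω, hω⟩ := card_pos.1 (pos F₀ subset_rfl)
  exact ⟨ω, (mem_filter.1 hω).2⟩

/-- Prescribed colors `c` on `B`, colors `f` elsewhere. -/
noncomputable def overwrite {V α : Type*} (B : Finset V) (c f : V → α) (v : V) : α :=
  if v ∈ B then c v else f v

theorem card_monochromatic_mul_le {V : Type*} [Fintype V] {r k : ℕ}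
    (B : Finset V) (c : V → Fin r) (e : Finset V) (hk : #e = k) (hk0 : 0 < k)
    (heB : #(e ∩ B) ≤ 1) (Q : (V → Fin r) → Prop)
    (hQ : ∀ f g : V → Fin r, (∀ v, v ∉ e \ B → f v = g v) → Q f → Q g) :
    r ^ (k - 1) * #{f | HG.Monochromatic (overwrite B c f) e ∧ Q f} ≤
      #{f : V → Fin r | Q f} := by
  obtain ⟨v₀, hv₀, hU⟩ : ∃ v₀ ∈ e, Disjoint (e.erase v₀) B := by
    rcases (e ∩ B).eq_empty_or_nonempty with h | ⟨v, hv⟩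
    · obtain ⟨v, hv⟩ := card_pos.1 (hk ▸ hk0)
      exact ⟨v, hv, (disjoint_iff_inter_eq_empty.2 h).mono_left (erase_subset _ _)⟩
    · refine ⟨v, (mem_inter.1 hv).1, disjoint_left.2 fun w hw hwB => ?_⟩
      exact (mem_erase.1 hw).1
        (card_le_one.1 heB w (mem_inter.2 ⟨(mem_erase.1 hw).2, hwB⟩) v hv)
  set U := e.erase v₀ with hUdef
  have hcard : #(Finset.univ : Finset (U → Fin r)) = r ^ (k - 1) := by
    rw [card_univ, Fintype.card_fun, Fintype.card_fin, Fintype.card_coe, hUdef,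
      card_erase_of_mem hv₀, hk]
  rw [← hcard, ← card_product]
  refine card_le_card_of_injOn
    (fun x v => if h : v ∈ U then x.1 ⟨v, h⟩ else x.2 v) ?_ ?_
  · rintro ⟨h, f⟩ hx
    simp only [coe_product, coe_univ, Set.mem_prod, Set.mem_univ, true_and, mem_coe,
      mem_filter, mem_univ] at hx ⊢
    refine hQ f _ (fun v hv => ?_) hx.2
    have : v ∉ U := fun hvU => hv (mem_sdiff.2 ⟨(mem_erase.1 hvU).2, disjoint_left.1 hU hvU⟩)
    simp [this]
  · rintro ⟨h, f⟩ hx ⟨h', f'⟩ hx' heq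
    simp only [coe_product, coe_univ, Set.mem_prod, Set.mem_univ, true_and, mem_coe,
      mem_filter, mem_univ] at hx hx'
    have hout : ∀ v, v ∉ U → f v = f' v := by
      intro v hv
      have := congrFun heq v
      simpa [hv] using this
    have hv₀U : v₀ ∉ U := by simp [hUdef]
    have hcol : overwrite B c f v₀ = overwrite B c f' v₀ := by
      unfold overwrite
      rw [hout v₀ hv₀U]
    refine Prod.ext (funext fun ⟨v, hv⟩ => ?_) (funext fun v => ?_)
    · have := congrFun heq v
      simpa [hv] using this
    · by_cases hv : v ∈ U
      · have hvB : v ∉ B := disjoint_left.1 hU hv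
        have h1 := hx.1 v (mem_erase.1 hv).2 v₀ hv₀
        have h2 := hx'.1 v (mem_erase.1 hv).2 v₀ hv₀
        rw [hcol, ← h2] at h1
        simpa [overwrite, hvB] using h1
      · exact hout v hv

theorem exists_proper_extension {V : Type*} [Fintype V] {r k : ℕ} (hr : 2 ≤ r) (hk : 3 ≤ k)
    (E : Finset (Finset V)) (hE : ∀ e ∈ E, #e = k) (B : Finset V) (c : V → Fin r)
    (hc : ∀ e ∈ E, e ⊆ B → ¬ HG.Monochromatic c e)
    (hB : ∀ e ∈ E, ¬ e ⊆ B → #(e ∩ B) ≤ 1)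
    (hdeg : ∀ v ∉ B, 4 * (k * #{e ∈ E | v ∈ e}) ≤ r ^ (k - 1)) :
    HG.RColorable r E := by
  have : NeZero r := ⟨by omega⟩
  set F₀ := E.filter fun e => ¬ e ⊆ B with hF₀
  have hK : 2 < r ^ (k - 1) :=
    calc 2 < 2 ^ 2 := by norm_num
      _ ≤ r ^ 2 := Nat.pow_le_pow_left hr 2
      _ ≤ r ^ (k - 1) := Nat.pow_le_pow_right (by omega) (by omega)
  obtain ⟨f, hf⟩ := exists_avoiding (Ω := V → Fin r)
    (fun e f => HG.Monochromatic (overwrite B c f) e)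
    (fun e f => ¬ Disjoint (e \ B) f) (r ^ (k - 1)) hK F₀ (by
      intro e he F hF hdis
      have heE := mem_filter.1 he
      convert card_monochromatic_mul_le B c e (hE e heE.1) (by omega) (hB e heE.1 heE.2)
        (fun f => ∀ e' ∈ F, ¬ HG.Monochromatic (overwrite B c f) e') ?_
      intro f g hfg hf e' he' hmono
      refine hf e' he' fun v hv w hw => ?_
      have hd := not_not.1 (hdis e' he')
      have : ∀ v ∈ e', overwrite B c f v = overwrite B c g v := by
        intro v hv
        unfold overwrite
        rw [hfg v fun h => disjoint_left.1 hd h hv]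
      rw [this v hv, this w hw]
      exact hmono v hv w hw) (by
      intro e he
      have heE := mem_filter.1 he
      have h1 : (F₀.filter fun f => ¬ Disjoint (e \ B) f) ⊆
          (e \ B).biUnion fun v => E.filter fun f => v ∈ f := by
        intro f hf
        obtain ⟨hf1, hf2⟩ := mem_filter.1 hf
        obtain ⟨v, hv, hv'⟩ := not_disjoint_iff.1 hf2
        exact mem_biUnion.2 ⟨v, hv, mem_filter.2 ⟨(mem_filter.1 hf1).1, hv'⟩⟩
      have h2 : k * #(F₀.filter fun f => ¬ Disjoint (e \ B) f) ≤
          ∑ v ∈ e \ B, k * #{f ∈ E | v ∈ f} := by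
        rw [← mul_sum]
        exact Nat.mul_le_mul_left _ ((card_le_card h1).trans card_biUnion_le)
      have h3 : 4 * ∑ v ∈ e \ B, k * #{f ∈ E | v ∈ f} ≤ k * r ^ (k - 1) := by
        rw [mul_sum]
        refine (sum_le_card_nsmul _ _ (r ^ (k - 1)) fun v hv => hdeg v (mem_sdiff.1 hv).2).trans ?_
        rw [smul_eq_mul]
        exact Nat.mul_le_mul_right _ ((card_le_card sdiff_subset).trans (hE e heE.1).le)
      have h4 : k * (4 * #(F₀.filter fun f => ¬ Disjoint (e \ B) f)) ≤ k * r ^ (k - 1) := by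
        linarith
      convert Nat.le_of_mul_le_mul_left h4 (by omega))
  refine ⟨overwrite B c f, fun e he => ?_⟩
  by_cases heB : e ⊆ B
  · intro hm
    refine hc e he heB fun v hv w hw => ?_
    simpa [overwrite, heB hv, heB hw] using hm v hv w hw
  · exact hf e (mem_filter.2 ⟨he, heB⟩)

theorem exists_coloring_of_sparse {V : Type*} {r k : ℕ} (hr : 2 ≤ r) (hk : 3 ≤ k)
    (E : Finset (Finset V)) (hE : ∀ e ∈ E, #e = k) (m : ℕ)
    (hsp : ∀ S : Finset V, S.Nonempty → #S ≤ m → (2 * k - 3) * #{e ∈ E | e ⊆ S} < 2 * #S)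
    (B : Finset V) (hB : #B ≤ m) :
    ∃ c : V → Fin r, ∀ e ∈ E, e ⊆ B → ¬ HG.Monochromatic c e := by
  have : NeZero r := ⟨by omega⟩
  have : Nontrivial (Fin r) := Fin.nontrivial_iff_two_le.2 hr
  induction B using Finset.strongInduction with
  | H B ih =>
    rcases B.eq_empty_or_nonempty with rfl | hne
    · refine ⟨fun _ => 0, fun e he h => ?_⟩
      have := hE e he
      rw [subset_empty.1 h, card_empty] at this
      omega
    obtain ⟨v, hv, hdv⟩ : ∃ v ∈ B, #{e ∈ E | e ⊆ B ∧ v ∈ e} ≤ 1 := by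
      by_contra! hcon
      have h1 : #B * 2 ≤ ∑ v ∈ B, #{e ∈ E | e ⊆ B ∧ v ∈ e} :=
        card_nsmul_le_sum B (fun v => #{e ∈ E | e ⊆ B ∧ v ∈ e}) 2 fun v hv => hcon v hv
      have h2 : ∑ v ∈ B, #{e ∈ E | e ⊆ B ∧ v ∈ e} = k * #{e ∈ E | e ⊆ B} := by
        have h3 := sum_card_bipartiteAbove_eq_sum_card_bipartiteBelow
          (s := B) (t := E.filter fun e => e ⊆ B) (fun v e => v ∈ e)
        simp only [bipartiteAbove, bipartiteBelow, filter_filter] at h3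
        rw [h3, mul_comm, ← smul_eq_mul]
        apply sum_eq_card_nsmul
        intro e he
        rw [← hE e (mem_filter.1 he).1]
        congr 1
        ext v
        simp only [mem_filter, and_iff_right_iff_imp]
        exact fun h => (mem_filter.1 he).2 h
      have h3 := hsp B hne hB
      have h4 : k * #{e ∈ E | e ⊆ B} ≤ (2 * k - 3) * #{e ∈ E | e ⊆ B} :=
        Nat.mul_le_mul_right _ (by omega)
      omega
    obtain ⟨c, hc⟩ := ih (B.erase v) (erase_ssubset hv) ((card_le_card (erase_subset _ _)).trans hB)
    have hsub : ∀ e ∈ E, e ⊆ B → v ∉ e → ∀ x, ¬ HG.Monochromatic (Function.update c v x) e := by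
      intro e he heB hve x hm
      refine hc e he (subset_erase.2 ⟨heB, hve⟩) fun a ha b hb => ?_
      have hav : a ≠ v := fun h => hve (h ▸ ha)
      have hbv : b ≠ v := fun h => hve (h ▸ hb)
      simpa [hav, hbv] using hm a ha b hb
    by_cases hex : ∃ e ∈ E, e ⊆ B ∧ v ∈ e
    · obtain ⟨e, he, heB, hve⟩ := hex
      obtain ⟨w, hw⟩ : (e.erase v).Nonempty := by
        rw [← card_pos, card_erase_of_mem hve, hE e he]
        omega
      obtain ⟨x, hx⟩ := exists_ne (c w)
      refine ⟨Function.update c v x, fun e' he' he'B => ?_⟩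
      by_cases hve' : v ∈ e'
      · have : e' = e := card_le_one.1 hdv e' (by simp [*]) e (by simp [*])
        subst this
        intro hm
        have := hm v hve w (mem_erase.1 hw).2
        simp [(mem_erase.1 hw).1] at this
        exact hx this
      · exact hsub e' he' he'B hve' x
    · push Not at hex
      refine ⟨Function.update c v 0, fun e he heB => hsub e he heB (hex e he heB) 0⟩

/-- Every small set is contained in a small set meeting each edge outside it at most once. -/
theorem exists_closure {V : Type*} [Fintype V] {k : ℕ} (hk : 3 ≤ k)
    (E : Finset (Finset V)) (hE : ∀ e ∈ E, #e = k) (B₀ : Finset V)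
    (hsp : ∀ S : Finset V, S.Nonempty → #S ≤ 3 * k * #B₀ →
      (2 * k - 3) * #{e ∈ E | e ⊆ S} < 2 * #S) :
    ∃ B, B₀ ⊆ B ∧ #B ≤ 3 * k * #B₀ ∧ ∀ e ∈ E, ¬ e ⊆ B → #(e ∩ B) ≤ 1 := by
  rcases B₀.eq_empty_or_nonempty with rfl | hne
  · exact ⟨∅, by simp, by simp, by simp⟩
  set b := #B₀ with hb
  have hb0 : 0 < b := card_pos.2 hne
  set 𝒲 := (Finset.univ : Finset (Finset V)).filter fun W =>
    B₀ ⊆ W ∧ #W ≤ 3 * k * b ∧ #W ≤ b + (k - 2) * #{e ∈ E | e ⊆ W} with h𝒲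
  obtain ⟨W, hW, hmax⟩ := exists_max_image 𝒲 card
    ⟨B₀, mem_filter.2 ⟨mem_univ _, subset_rfl, by nlinarith, by omega⟩⟩
  obtain ⟨-, hW1, hW2, hW3⟩ := mem_filter.1 hW
  refine ⟨W, hW1, hW2, fun e he heW => ?_⟩
  by_contra! hcon
  have h1 := hsp W (hne.mono hW1) hW2
  set t := #{e ∈ E | e ⊆ W} with ht
  obtain ⟨l, rfl⟩ : ∃ l, k = l + 3 := ⟨k - 3, by omega⟩
  have ha : 2 * (l + 3) - 3 = 2 * l + 3 := by omega
  have ha' : l + 3 - 2 = l + 1 := by omega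
  rw [ha] at h1
  rw [ha'] at hW3
  have ht2 : t < 2 * b := by nlinarith
  have hWe : #(W ∪ e) ≤ #W + (l + 1) := by
    have := card_union_add_card_inter W e
    rw [hE e he, inter_comm] at this
    omega
  have hlt : #W < #(W ∪ e) := card_lt_card ⟨subset_union_left, fun h =>
    heW (subset_union_right.trans h)⟩
  have ht' : t + 1 ≤ #{f ∈ E | f ⊆ W ∪ e} := by
    rw [ht, Nat.succ_le_iff]
    apply card_lt_card
    refine ⟨fun f hf => ?_, fun h => ?_⟩
    · exact mem_filter.2 ⟨(mem_filter.1 hf).1, (mem_filter.1 hf).2.trans subset_union_left⟩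
    · exact heW (mem_filter.1 (h (mem_filter.2 ⟨he, subset_union_right⟩))).2
  have hmem : W ∪ e ∈ 𝒲 := by
    refine mem_filter.2 ⟨mem_univ _, hW1.trans subset_union_left, ?_, ?_⟩
    · nlinarith
    · rw [ha']
      nlinarith
  have := hmax _ hmem
  omega

theorem rColorable_of_sparse {V : Type*} [Fintype V] {r k : ℕ} (hr : 2 ≤ r) (hk : 3 ≤ k)
    (E : Finset (Finset V)) (hE : ∀ e ∈ E, #e = k) (s : ℕ)
    (hs : #{v | r ^ (k - 1) < 4 * (k * #{e ∈ E | v ∈ e})} ≤ s)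
    (hsp : ∀ S : Finset V, S.Nonempty → #S ≤ 3 * k * s →
      (2 * k - 3) * #{e ∈ E | e ⊆ S} < 2 * #S) :
    HG.RColorable r E := by
  set B₀ : Finset V := {v | r ^ (k - 1) < 4 * (k * #{e ∈ E | v ∈ e})} with hB₀
  have hle : 3 * k * #B₀ ≤ 3 * k * s := Nat.mul_le_mul_left _ hs
  obtain ⟨B, h1, h2, h3⟩ := exists_closure hk E hE B₀ fun S hS hSs => hsp S hS (hSs.trans hle)
  obtain ⟨c, hc⟩ := exists_coloring_of_sparse hr hk E hE _ hsp B (h2.trans hle)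
  refine exists_proper_extension hr hk E hE B c hc h3 fun v hv => ?_
  by_contra! hcon
  exact hv (h1 (mem_filter.2 ⟨mem_univ _, hcon⟩))

section Probability

variable {n k : ℕ} {p : ℝ}

theorem hyperProb_term_nonneg (hp0 : 0 ≤ p) (hp1 : p ≤ 1) (a b : ℕ) : 0 ≤ p ^ a * (1 - p) ^ b :=
  mul_nonneg (pow_nonneg hp0 _) (pow_nonneg (sub_nonneg.2 hp1) _)

theorem hyperProb_nonneg (hp0 : 0 ≤ p) (hp1 : p ≤ 1) (P : Finset (Finset (Fin n)) → Prop) :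
    0 ≤ HG.hyperProb n k p P := by
  refine sum_nonneg fun E _ => ?_
  split_ifs
  · exact hyperProb_term_nonneg hp0 hp1 _ _
  · exact le_rfl

theorem hyperProb_add_not (P : Finset (Finset (Fin n)) → Prop) :
    HG.hyperProb n k p P + HG.hyperProb n k p (fun E => ¬ P E) = 1 := by
  unfold HG.hyperProb
  rw [← sum_add_distrib]
  have h := sum_pow_mul_eq_add_pow p (1 - p) ((Finset.univ : Finset (Fin n)).powersetCard k)
  rw [add_sub_cancel, one_pow] at h
  refine (sum_congr rfl fun E _ => ?_).trans h
  by_cases hP : P E <;> simp [hP]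

theorem hyperProb_mono (hp0 : 0 ≤ p) (hp1 : p ≤ 1) {P Q : Finset (Finset (Fin n)) → Prop}
    (h : ∀ E, (∀ e ∈ E, #e = k) → P E → Q E) :
    HG.hyperProb n k p P ≤ HG.hyperProb n k p Q := by
  refine sum_le_sum fun E hE => ?_
  have hE' : ∀ e ∈ E, #e = k := fun e he => (mem_powersetCard.1 (mem_powerset.1 hE he)).2
  have := hyperProb_term_nonneg hp0 hp1 #E
    (#((Finset.univ : Finset (Fin n)).powersetCard k) - #E)
  by_cases hP : P E
  · simp [hP, h E hE' hP]
  · by_cases hQ : Q E <;> simp only [hP, hQ, if_true, if_false, le_refl, this]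

theorem hyperProb_or_le (hp0 : 0 ≤ p) (hp1 : p ≤ 1) (P Q : Finset (Finset (Fin n)) → Prop) :
    HG.hyperProb n k p (fun E => P E ∨ Q E) ≤ HG.hyperProb n k p P + HG.hyperProb n k p Q := by
  unfold HG.hyperProb
  rw [← sum_add_distrib]
  refine sum_le_sum fun E _ => ?_
  have := hyperProb_term_nonneg hp0 hp1 #E
    (#((Finset.univ : Finset (Fin n)).powersetCard k) - #E)
  by_cases hP : P E <;> by_cases hQ : Q E <;>
    simp only [hP, hQ, or_true, true_or, or_self, if_true, if_false] <;> linarith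

theorem hyperProb_exists_le (hp0 : 0 ≤ p) (hp1 : p ≤ 1) {ι : Type*} (I : Finset ι)
    (Q : ι → Finset (Finset (Fin n)) → Prop) :
    HG.hyperProb n k p (fun E => ∃ i ∈ I, Q i E) ≤ ∑ i ∈ I, HG.hyperProb n k p (Q i) := by
  unfold HG.hyperProb
  rw [sum_comm]
  refine sum_le_sum fun E _ => ?_
  have h0 := hyperProb_term_nonneg hp0 hp1 #E
    (#((Finset.univ : Finset (Fin n)).powersetCard k) - #E)
  have h1 : ∀ i ∈ I, 0 ≤ if Q i E then p ^ #E *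
      (1 - p) ^ (#((Finset.univ : Finset (Fin n)).powersetCard k) - #E) else 0 := by
    intro i _
    split_ifs
    · exact h0
    · exact le_rfl
  by_cases h : ∃ i ∈ I, Q i E
  · obtain ⟨i, hi, hQ⟩ := h
    rw [if_pos ⟨i, hi, hQ⟩]
    refine le_trans ?_ (single_le_sum h1 hi)
    rw [if_pos hQ]
  · rw [if_neg h]
    exact sum_nonneg h1

/-- Exponential moment bound. -/
theorem hyperProb_le_exp_div (hp0 : 0 ≤ p) (hp1 : p ≤ 1) (P : Finset (Finset (Fin n)) → Prop)
    (g : Finset (Fin n) → ℝ) (hg : ∀ e, 0 ≤ g e) {M : ℝ} (hM : 0 < M)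
    (hP : ∀ E, (∀ e ∈ E, #e = k) → P E → M ≤ ∏ e ∈ E, g e) :
    HG.hyperProb n k p P ≤
      Real.exp (p * ∑ e ∈ (Finset.univ : Finset (Fin n)).powersetCard k, (g e - 1)) / M := by
  rw [le_div_iff₀ hM]
  set 𝒦 := (Finset.univ : Finset (Fin n)).powersetCard k with h𝒦
  calc HG.hyperProb n k p P * M
      ≤ ∑ E ∈ 𝒦.powerset, (∏ e ∈ E, p * g e) * ∏ e ∈ 𝒦 \ E, (1 - p) := by
        unfold HG.hyperProb
        rw [sum_mul]
        refine sum_le_sum fun E hE => ?_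
        have hE' : ∀ e ∈ E, #e = k := fun e he => (mem_powersetCard.1 (mem_powerset.1 hE he)).2
        have h0 := hyperProb_term_nonneg hp0 hp1 #E (#𝒦 - #E)
        have hprod : (∏ e ∈ E, p * g e) * ∏ e ∈ 𝒦 \ E, (1 - p) =
            p ^ #E * (1 - p) ^ (#𝒦 - #E) * ∏ e ∈ E, g e := by
          rw [prod_mul_distrib, prod_const, prod_const, card_sdiff_of_subset (mem_powerset.1 hE)]
          ring
        rw [hprod]
        by_cases h : P E
        · rw [if_pos h]
          exact mul_le_mul_of_nonneg_left (hP E hE' h) h0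
        · rw [if_neg h, zero_mul]
          exact mul_nonneg h0 (prod_nonneg fun e _ => hg e)
    _ = ∏ e ∈ 𝒦, (p * g e + (1 - p)) := (prod_add _ _ _).symm
    _ ≤ ∏ e ∈ 𝒦, Real.exp (p * (g e - 1)) := by
        refine prod_le_prod (fun e _ => ?_) fun e _ => ?_
        · have := mul_nonneg hp0 (hg e)
          linarith
        · have := Real.add_one_le_exp (p * (g e - 1))
          linarith
    _ = _ := by rw [← Real.exp_sum, mul_sum]

theorem choose_mul_pow_le {s n : ℕ} (hsn : s ≤ n) (j : ℕ) :
    s.choose j * n ^ j ≤ n.choose j * s ^ j := by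
  have key : s.descFactorial j * n ^ j ≤ n.descFactorial j * s ^ j := by
    induction j with
    | zero => simp
    | succ j ih =>
      have h : (s - j) * n ≤ (n - j) * s := by
        rw [Nat.sub_mul, Nat.sub_mul, mul_comm n s]
        exact Nat.sub_le_sub_left (Nat.mul_le_mul_left j hsn) _
      rw [Nat.descFactorial_succ, Nat.descFactorial_succ, pow_succ, pow_succ]
      calc _ = ((s - j) * n) * (s.descFactorial j * n ^ j) := by ring
        _ ≤ ((n - j) * s) * (n.descFactorial j * s ^ j) := Nat.mul_le_mul h ih
        _ = _ := by ring
  rw [Nat.descFactorial_eq_factorial_mul_choose, Nat.descFactorial_eq_factorial_mul_choose,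
    mul_assoc, mul_assoc] at key
  exact Nat.le_of_mul_le_mul_left key (Nat.factorial_pos j)

theorem choose_le_choose_mul_div_pow {s n : ℕ} (hn : 0 < n) (hsn : s ≤ n) (j : ℕ) :
    (s.choose j : ℝ) ≤ n.choose j * ((s : ℝ) / n) ^ j := by
  rw [div_pow, mul_div_assoc', le_div_iff₀ (by positivity)]
  exact_mod_cast choose_mul_pow_le hsn j

theorem card_filter_superset_le (A : Finset (Fin n)) :
    #{e ∈ (Finset.univ : Finset (Fin n)).powersetCard k | A ⊆ e} * n.choose #A ≤
      n.choose k * k.choose #A := by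
  by_cases hA : #A ≤ k
  · by_cases hk : k ≤ n
    · rw [Nat.choose_mul hA, mul_comm]
      refine Nat.mul_le_mul_left _ ?_
      have : (n - #A).choose (k - #A) = #((Finset.univ \ A).powersetCard (k - #A)) := by
        rw [card_powersetCard, card_sdiff_of_subset (subset_univ _), card_univ, Fintype.card_fin]
      rw [this]
      refine card_le_card_of_injOn (fun e => e \ A) ?_ ?_
      · intro e he
        simp only [coe_filter, mem_powersetCard, Set.mem_ofPred_eq] at he
        simp only [mem_coe, mem_powersetCard]
        exact ⟨sdiff_subset_sdiff (subset_univ _) subset_rfl, by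
          rw [card_sdiff_of_subset he.2, he.1.2]⟩
      · intro e he f hf h
        simp only [coe_filter, mem_powersetCard, Set.mem_ofPred_eq] at he hf
        have h' : e \ A = f \ A := h
        rw [← sdiff_union_of_subset he.2, h', sdiff_union_of_subset hf.2]
    · rw [powersetCard_eq_empty.2 (by simpa using hk)]
      simp
  · have : #{e ∈ (Finset.univ : Finset (Fin n)).powersetCard k | A ⊆ e} = 0 := by
      rw [card_eq_zero, filter_eq_empty_iff]
      intro e he hAe
      exact hA ((card_le_card hAe).trans (mem_powersetCard.1 he).2.le)
    rw [this]
    simp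

theorem sum_two_pow_card_inter_le (hn : 0 < n) (S : Finset (Fin n)) :
    ∑ e ∈ (Finset.univ : Finset (Fin n)).powersetCard k, (2 : ℝ) ^ #(e ∩ S) ≤
      n.choose k * (1 + (#S : ℝ) / n) ^ k := by
  have hSn : #S ≤ n := by simpa using card_le_univ S
  calc ∑ e ∈ (Finset.univ : Finset (Fin n)).powersetCard k, (2 : ℝ) ^ #(e ∩ S)
      = ∑ A ∈ S.powerset, (#{e ∈ (Finset.univ : Finset (Fin n)).powersetCard k | A ⊆ e} : ℝ) := by
        have h := sum_card_bipartiteAbove_eq_sum_card_bipartiteBelow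
          (s := (Finset.univ : Finset (Fin n)).powersetCard k) (t := S.powerset) (fun e A => A ⊆ e)
        simp only [bipartiteAbove, bipartiteBelow] at h
        rw [← Nat.cast_sum, ← h, Nat.cast_sum]
        refine sum_congr rfl fun e _ => ?_
        have : S.powerset.filter (fun A => A ⊆ e) = (e ∩ S).powerset := by
          ext A
          simp only [mem_filter, mem_powerset, subset_inter_iff]
          tauto
        rw [this, card_powerset]
        norm_num
    _ ≤ ∑ A ∈ S.powerset, (n.choose k * k.choose #A / n.choose #A : ℝ) := by
        refine sum_le_sum fun A hA => ?_
        have hpos : 0 < n.choose #A :=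
          Nat.choose_pos ((card_le_card (mem_powerset.1 hA)).trans hSn)
        rw [le_div_iff₀ (by exact_mod_cast hpos)]
        exact_mod_cast card_filter_superset_le A
    _ = ∑ j ∈ range (#S + 1), (#S).choose j • (n.choose k * k.choose j / n.choose j : ℝ) :=
        sum_powerset_apply_card (fun j => (n.choose k * k.choose j / n.choose j : ℝ))
    _ ≤ ∑ j ∈ range (#S + 1), (n.choose k * (k.choose j * ((#S : ℝ) / n) ^ j) : ℝ) := by
        refine sum_le_sum fun j hj => ?_
        have hpos : (0 : ℝ) < n.choose j := by
          exact_mod_cast Nat.choose_pos ((Nat.lt_succ_iff.1 (mem_range.1 hj)).trans hSn)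
        rw [nsmul_eq_mul, mul_div_assoc', div_le_iff₀ hpos]
        have := mul_le_mul_of_nonneg_left (choose_le_choose_mul_div_pow hn hSn j)
          (by positivity : (0 : ℝ) ≤ n.choose k * k.choose j)
        linarith
    _ ≤ ∑ j ∈ range (#S + k + 1), (n.choose k * (k.choose j * ((#S : ℝ) / n) ^ j) : ℝ) := by
        refine sum_le_sum_of_subset_of_nonneg (range_mono (by omega)) fun j _ _ => by positivity
    _ = ∑ j ∈ range (k + 1), (n.choose k * (k.choose j * ((#S : ℝ) / n) ^ j) : ℝ) := by
        refine (sum_subset (range_mono (by omega)) fun j _ hj => ?_).symm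
        rw [show k.choose j = 0 from Nat.choose_eq_zero_of_lt (by simpa [Nat.lt_succ_iff] using hj)]
        simp
    _ = n.choose k * (1 + (#S : ℝ) / n) ^ k := by
        rw [← mul_sum, add_comm (1 : ℝ), add_pow]
        simp [mul_comm]

theorem hyperProb_high_degree_le (hp0 : 0 ≤ p) (hp1 : p ≤ 1) (hn : 0 < n) (hk : 0 < k)
    {D : ℝ} (hD : p * n.choose k ≤ D * n) (S : Finset (Fin n)) (hS : k * #S ≤ n) (K : ℕ) :
    HG.hyperProb n k p (fun E => ∀ v ∈ S, K < 4 * (k * #{e ∈ E | v ∈ e})) ≤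
      Real.exp (2 * k * D * #S - #S * (K / (8 * k))) := by
  have hnR : (0 : ℝ) < n := by exact_mod_cast hn
  have hkR : (0 : ℝ) < k := by exact_mod_cast hk
  have hD0 : 0 ≤ D := by
    have : 0 ≤ D * n := le_trans (by positivity) hD
    exact nonneg_of_mul_nonneg_left this hnR
  refine (hyperProb_le_exp_div hp0 hp1 _ (fun e => (2 : ℝ) ^ #(e ∩ S)) (fun e => by positivity)
    (Real.exp_pos (#S * (K / (8 * k)))) ?_).trans ?_
  · intro E _ hE
    rw [prod_pow_eq_pow_sum]
    have hsum : ∑ e ∈ E, #(e ∩ S) = ∑ v ∈ S, #{e ∈ E | v ∈ e} := by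
      have h := sum_card_bipartiteAbove_eq_sum_card_bipartiteBelow
        (s := S) (t := E) (fun v e => v ∈ e)
      simp only [bipartiteAbove, bipartiteBelow] at h
      rw [h]
      refine sum_congr rfl fun e _ => ?_
      rw [inter_comm, ← filter_mem_eq_inter]
    have hlow : (#S : ℝ) * (K / (4 * k)) ≤ (∑ e ∈ E, #(e ∩ S) : ℕ) := by
      rw [hsum, Nat.cast_sum, ← nsmul_eq_mul]
      refine card_nsmul_le_sum _ _ _ fun v hv => ?_
      rw [div_le_iff₀ (by positivity)]
      have : (K : ℝ) < 4 * (k * #{e ∈ E | v ∈ e}) := by exact_mod_cast hE v hv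
      linarith
    have h2 : Real.exp (1 / 2) ≤ 2 := by
      rw [← Real.le_log_iff_exp_le (by norm_num)]
      linarith [Real.log_two_gt_d9]
    calc Real.exp (#S * (K / (8 * k)))
        ≤ Real.exp ((∑ e ∈ E, #(e ∩ S) : ℕ) * (1 / 2)) := by
          apply Real.exp_le_exp.2
          have : (K : ℝ) / (8 * k) = K / (4 * k) * (1 / 2) := by
            field_simp
            ring
          rw [this, ← mul_assoc]
          exact mul_le_mul_of_nonneg_right hlow (by norm_num)
      _ = Real.exp (1 / 2) ^ (∑ e ∈ E, #(e ∩ S)) := Real.exp_nat_mul _ _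
      _ ≤ _ := pow_le_pow_left₀ (Real.exp_pos _).le h2 _
  · rw [Real.exp_sub]
    refine div_le_div_of_nonneg_right (Real.exp_le_exp.2 ?_) (Real.exp_pos _).le
    rw [sum_sub_distrib, sum_const, card_powersetCard, card_univ, Fintype.card_fin, nsmul_eq_mul,
      mul_one]
    have hx1 : (k : ℝ) * (#S / n) ≤ 1 := by
      rw [mul_div_assoc', div_le_one hnR]
      exact_mod_cast hS
    have hx0 : (0 : ℝ) ≤ k * (#S / n) := by positivity
    have hpow : (1 + (#S : ℝ) / n) ^ k ≤ 1 + 2 * (k * (#S / n)) := by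
      calc (1 + (#S : ℝ) / n) ^ k ≤ Real.exp (#S / n) ^ k := by
            refine pow_le_pow_left₀ (by positivity) ?_ _
            linarith [Real.add_one_le_exp ((#S : ℝ) / n)]
        _ = Real.exp (k * (#S / n)) := (Real.exp_nat_mul _ _).symm
        _ ≤ _ := by
            have := Real.abs_exp_sub_one_le (x := k * ((#S : ℝ) / n)) (by rwa [abs_of_nonneg hx0])
            rw [abs_of_nonneg hx0] at this
            linarith [(abs_le.1 this).2]
    calc p * (∑ e ∈ (Finset.univ : Finset (Fin n)).powersetCard k, (2 : ℝ) ^ #(e ∩ S) - n.choose k)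
        ≤ p * (n.choose k * (1 + 2 * (k * (#S / n))) - n.choose k) := by
          refine mul_le_mul_of_nonneg_left (sub_le_sub_right ?_ _) hp0
          exact (sum_two_pow_card_inter_le hn S).trans
            (mul_le_mul_of_nonneg_left hpow (by positivity))
      _ = p * n.choose k * (2 * (k * (#S / n))) := by ring
      _ ≤ D * n * (2 * (k * (#S / n))) := mul_le_mul_of_nonneg_right hD (by positivity)
      _ = 2 * k * D * #S := by field_simp

theorem hyperProb_dense_le (hp0 : 0 ≤ p) (hp1 : p ≤ 1) (hn : 0 < n)
    {D : ℝ} (hD : p * n.choose k ≤ D * n) (S : Finset (Fin n)) (w : ℕ) {y : ℝ} (hy : 1 ≤ y) :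
    HG.hyperProb n k p (fun E => 2 * #S ≤ w * #{e ∈ E | e ⊆ S}) ≤
      Real.exp (D * n * (#S / n) ^ k * y ^ w) / y ^ (2 * #S) := by
  have hSn : #S ≤ n := by simpa using card_le_univ S
  have hy0 : 0 < y := by linarith
  refine (hyperProb_le_exp_div hp0 hp1 _ (fun e => if e ⊆ S then y ^ w else 1)
    (fun e => by split_ifs <;> positivity) (pow_pos hy0 (2 * #S)) ?_).trans ?_
  · intro E _ hE
    rw [prod_ite, prod_const, prod_const_one, mul_one, ← pow_mul]
    exact pow_le_pow_right₀ hy hE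
  · refine div_le_div_of_nonneg_right (Real.exp_le_exp.2 ?_) (by positivity)
    have h1 : ∑ e ∈ (Finset.univ : Finset (Fin n)).powersetCard k,
        ((if e ⊆ S then y ^ w else 1) - 1) = (#S).choose k * (y ^ w - 1) := by
      have h2 : ∀ e : Finset (Fin n), ((if e ⊆ S then y ^ w else 1) - 1) =
          if e ⊆ S then y ^ w - 1 else 0 := fun e => by split_ifs <;> simp
      simp_rw [h2]
      rw [← sum_filter, sum_const, nsmul_eq_mul]
      congr 2
      rw [← card_powersetCard]
      congr 1
      ext e
      simp [mem_powersetCard, and_comm]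
    rw [h1]
    calc p * ((#S).choose k * (y ^ w - 1)) ≤ p * ((n.choose k * (#S / n) ^ k) * y ^ w) := by
          refine mul_le_mul_of_nonneg_left ?_ hp0
          refine mul_le_mul (choose_le_choose_mul_div_pow hn hSn k) (by linarith) ?_ (by positivity)
          linarith [one_le_pow₀ hy (n := w)]
      _ = p * n.choose k * ((#S / n) ^ k * y ^ w) := by ring
      _ ≤ D * n * ((#S / n) ^ k * y ^ w) := mul_le_mul_of_nonneg_right hD (by positivity)
      _ = _ := by ring

end Probability

theorem choose_le_exp_mul_pow (n : ℕ) {j : ℕ} (hj : 0 < j) :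
    (n.choose j : ℝ) ≤ Real.exp j * ((n : ℝ) / j) ^ j := by
  have hjR : (0 : ℝ) < j := by exact_mod_cast hj
  have h1 : (n.choose j : ℝ) ≤ n ^ j / j.factorial := Nat.choose_le_pow_div j n
  have h2 := Real.pow_div_factorial_le_exp (j : ℝ) hjR.le j
  calc (n.choose j : ℝ) ≤ n ^ j / j.factorial := h1
    _ = ((j : ℝ) ^ j / j.factorial) * ((n : ℝ) / j) ^ j := by
        rw [div_pow]
        field_simp
    _ ≤ _ := mul_le_mul_of_nonneg_right h2 (by positivity)

theorem choose_mul_exp_div_pow_le {n k j : ℕ} {D u q : ℝ} (hn : 0 < n) (hk : 3 ≤ k) (hj : 0 < j)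
    (hu : 0 < u) (hux : u ^ 2 = (j : ℝ) / n) (hq : 0 < q) (h : D * u * q ^ (2 * k - 3) ≤ 1) :
    n.choose j * (Real.exp (D * n * ((j : ℝ) / n) ^ k * (q / u) ^ (2 * k - 3)) /
      (q / u) ^ (2 * j)) ≤ Real.exp (2 * j) / q ^ (2 * j) := by
  have hnR : (0 : ℝ) < n := by exact_mod_cast hn
  have hjR : (0 : ℝ) < j := by exact_mod_cast hj
  have hj' : (j : ℝ) = n * u ^ 2 := by
    rw [hux]
    field_simp
  have hexp : D * n * ((j : ℝ) / n) ^ k * (q / u) ^ (2 * k - 3) ≤ j := by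
    have h1 : ((j : ℝ) / n) ^ k = u ^ (2 * k - 3) * u ^ 3 := by
      rw [← hux, ← pow_mul, ← pow_add]
      congr 1
      omega
    have h2 : D * n * ((j : ℝ) / n) ^ k * (q / u) ^ (2 * k - 3) =
        n * u ^ 2 * (D * u * q ^ (2 * k - 3)) := by
      rw [h1, div_pow]
      field_simp
    rw [h2, ← hj']
    nlinarith
  have hnj : ((n : ℝ) / j) ^ j = 1 / u ^ (2 * j) := by
    rw [pow_mul, hux, ← one_div_pow, one_div_div]
  calc n.choose j * (Real.exp (D * n * ((j : ℝ) / n) ^ k * (q / u) ^ (2 * k - 3)) /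
        (q / u) ^ (2 * j))
      ≤ (Real.exp j * ((n : ℝ) / j) ^ j) * (Real.exp j / (q / u) ^ (2 * j)) := by
        refine mul_le_mul (choose_le_exp_mul_pow n hj) ?_ (by positivity) (by positivity)
        exact div_le_div_of_nonneg_right (Real.exp_le_exp.2 hexp) (by positivity)
    _ = Real.exp (2 * j) / q ^ (2 * j) := by
        rw [hnj, two_mul (j : ℝ), Real.exp_add, div_pow]
        field_simp

theorem mul_sqrt_mul_exp_pow_le_one {n k j : ℕ} {D : ℝ} (hn : 0 < n) (hk : 3 ≤ k) (hkj : k ≤ j)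
    (hD : 80 ≤ D) (hDn : k * D ≤ Real.log n)
    (hjn : (j : ℝ) ≤ 3 * k * (n * Real.exp (-(k * D)))) :
    D * √((j : ℝ) / n) * Real.exp (2 + Real.log n / (8 * j)) ^ (2 * k - 3) ≤ 1 := by
  have hnR : (0 : ℝ) < n := by exact_mod_cast hn
  have hkR : (3 : ℝ) ≤ k := by exact_mod_cast hk
  have hkjR : (k : ℝ) ≤ j := by exact_mod_cast hkj
  have hjR : (0 : ℝ) < j := by linarith
  set ℓ := Real.log n with hℓ
  have hℓ0 : 240 ≤ ℓ := by nlinarith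
  have hne : (n : ℝ) = Real.exp ℓ := (Real.exp_log hnR).symm
  set x : ℝ := (j : ℝ) / n with hx
  have hx0 : 0 ≤ x := by positivity
  set q := Real.exp (2 + ℓ / (8 * j)) with hq
  have hq1 : 1 ≤ q := Real.one_le_exp (by positivity)
  have hsq : D ^ 2 * x * Real.exp (8 * k + k * ℓ / (2 * j)) ≤ 1 := by
    rcases le_total ℓ j with hlj | hjl
    · have h1 : x ≤ 3 * k * Real.exp (-(k * D)) := by
        rw [hx, div_le_iff₀ hnR]
        linarith
      have h2 : k * ℓ / (2 * j) ≤ k / 2 := by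
        rw [div_le_div_iff₀ (by positivity) (by norm_num)]
        nlinarith
      have h3 : D ^ 2 * (3 * k) ≤ Real.exp (k * D / 2) := by
        have h := Real.pow_div_factorial_le_exp (k * D / 2) (by positivity) 3
        refine le_trans ?_ h
        rw [le_div_iff₀ (by positivity)]
        norm_num [Nat.factorial]
        have : 144 ≤ k ^ 2 * D := by nlinarith
        have h4 : 0 ≤ k * D ^ 2 * (k ^ 2 * D - 144) :=
          mul_nonneg (by positivity) (by linarith)
        nlinarith
      calc D ^ 2 * x * Real.exp (8 * k + k * ℓ / (2 * j))
          ≤ D ^ 2 * (3 * k * Real.exp (-(k * D))) * Real.exp (8 * k + k / 2) := by gcongr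
        _ = (D ^ 2 * (3 * k)) * (Real.exp (-(k * D)) * Real.exp (8 * k + k / 2)) := by ring
        _ ≤ Real.exp (k * D / 2) * (Real.exp (-(k * D)) * Real.exp (8 * k + k / 2)) := by gcongr
        _ = Real.exp (k * D / 2 + (-(k * D) + (8 * k + k / 2))) := by
            rw [Real.exp_add (k * D / 2), Real.exp_add (-(k * D))]
        _ ≤ 1 := by
            rw [Real.exp_le_one_iff]
            nlinarith
    · have h1 : x ≤ ℓ * Real.exp (-ℓ) := by
        rw [hx, hne, Real.exp_neg, ← div_eq_mul_inv]
        gcongr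
      have h2 : k * ℓ / (2 * j) ≤ ℓ / 2 := by
        rw [div_le_div_iff₀ (by positivity) (by norm_num)]
        nlinarith
      have h3 : 8 * (k : ℝ) ≤ ℓ / 10 := by nlinarith
      have h4 : D ≤ ℓ / 3 := by nlinarith
      have h5 : (ℓ / 3) ^ 2 * ℓ ≤ Real.exp (2 / 5 * ℓ) := by
        have h := Real.pow_div_factorial_le_exp (2 / 5 * ℓ) (by positivity) 4
        refine le_trans ?_ h
        rw [le_div_iff₀ (by positivity)]
        norm_num [Nat.factorial]
        have h6 : 0 ≤ ℓ ^ 3 * (ℓ - 240) := mul_nonneg (by positivity) (by linarith)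
        have h7 : 0 ≤ ℓ ^ 3 := by positivity
        nlinarith
      calc D ^ 2 * x * Real.exp (8 * k + k * ℓ / (2 * j))
          ≤ (ℓ / 3) ^ 2 * (ℓ * Real.exp (-ℓ)) * Real.exp (ℓ / 10 + ℓ / 2) := by gcongr
        _ = ((ℓ / 3) ^ 2 * ℓ) * (Real.exp (-ℓ) * Real.exp (ℓ / 10 + ℓ / 2)) := by ring
        _ ≤ Real.exp (2 / 5 * ℓ) * (Real.exp (-ℓ) * Real.exp (ℓ / 10 + ℓ / 2)) := by gcongr
        _ = Real.exp (2 / 5 * ℓ + (-ℓ + (ℓ / 10 + ℓ / 2))) := by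
            rw [Real.exp_add (2 / 5 * ℓ), Real.exp_add (-ℓ)]
        _ = 1 := by
            rw [Real.exp_eq_one_iff]
            ring
  have hle : D * √x * q ^ (2 * k - 3) ≤ D * √x * q ^ (2 * k) := by
    gcongr
    omega
  refine hle.trans ?_
  rw [← sq_le_one_iff₀ (by positivity)]
  calc (D * √x * q ^ (2 * k)) ^ 2 = D ^ 2 * (√x) ^ 2 * q ^ (2 * k * 2) := by ring
    _ = D ^ 2 * x * Real.exp (8 * k + k * ℓ / (2 * j)) := by
        rw [Real.sq_sqrt hx0, hq, ← Real.exp_nat_mul]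
        congr 2
        push_cast
        field_simp
        ring
    _ ≤ 1 := hsq

section UnionBounds

variable {n k : ℕ} {p D : ℝ}

theorem hyperProb_exists_dense_le (hp0 : 0 ≤ p) (hp1 : p ≤ 1) (hn : 0 < n) (hk : 3 ≤ k)
    (hpD : p * n.choose k ≤ D * n) (hD : 80 ≤ D) {j : ℕ} (hkj : k ≤ j)
    (hDn : k * D ≤ Real.log n) (hjn : (j : ℝ) ≤ 3 * k * (n * Real.exp (-(k * D)))) :
    HG.hyperProb n k p (fun E => ∃ S ∈ (Finset.univ : Finset (Fin n)).powersetCard j,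
      2 * #S ≤ (2 * k - 3) * #{e ∈ E | e ⊆ S}) ≤
      Real.exp (-(Real.log n / 4)) * (1 / 2) ^ j := by
  have hnR : (0 : ℝ) < n := by exact_mod_cast hn
  have hkR : (3 : ℝ) ≤ k := by exact_mod_cast hk
  have hj : 0 < j := by omega
  have hjR : (0 : ℝ) < j := by exact_mod_cast hj
  set u := √((j : ℝ) / n) with hu
  set q := Real.exp (2 + Real.log n / (8 * j)) with hq
  have hu0 : 0 < u := Real.sqrt_pos.2 (by positivity)
  have hq0 : 0 < q := Real.exp_pos _
  have hℓ : 0 ≤ Real.log n := le_trans (by positivity) hDn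
  have hq1 : 1 ≤ q := Real.one_le_exp (by positivity)
  have hcond := mul_sqrt_mul_exp_pow_le_one hn hk hkj hD hDn hjn
  have hu1 : u ≤ 1 := by
    have : 1 ≤ q ^ (2 * k - 3) := one_le_pow₀ hq1
    have h2 : u ≤ D * u := by nlinarith
    have h3 : D * u ≤ D * u * q ^ (2 * k - 3) :=
      le_mul_of_one_le_right (by positivity) this
    linarith
  have hy : 1 ≤ q / u := by
    rw [one_le_div hu0]
    linarith
  calc _ ≤ ∑ S ∈ (Finset.univ : Finset (Fin n)).powersetCard j, HG.hyperProb n k p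
          (fun E => 2 * #S ≤ (2 * k - 3) * #{e ∈ E | e ⊆ S}) := hyperProb_exists_le hp0 hp1 _ _
    _ ≤ ∑ S ∈ (Finset.univ : Finset (Fin n)).powersetCard j,
          (Real.exp (D * n * ((j : ℝ) / n) ^ k * (q / u) ^ (2 * k - 3)) / (q / u) ^ (2 * j)) := by
        refine sum_le_sum fun S hS => ?_
        have := hyperProb_dense_le hp0 hp1 hn hpD S (2 * k - 3) hy
        rwa [(mem_powersetCard.1 hS).2] at this ⊢
    _ = n.choose j *
          (Real.exp (D * n * ((j : ℝ) / n) ^ k * (q / u) ^ (2 * k - 3)) / (q / u) ^ (2 * j)) := by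
        rw [sum_const, card_powersetCard, card_univ, Fintype.card_fin, nsmul_eq_mul]
    _ ≤ Real.exp (2 * j) / q ^ (2 * j) :=
        choose_mul_exp_div_pow_le hn hk hj hu0 (Real.sq_sqrt (by positivity)) hq0 hcond
    _ = Real.exp (-(Real.log n / 4)) * Real.exp (j * (-2)) := by
        rw [hq, ← Real.exp_nat_mul, ← Real.exp_sub, ← Real.exp_add]
        congr 1
        push_cast
        field_simp
        ring
    _ ≤ _ := by
        rw [Real.exp_nat_mul]
        gcongr
        rw [Real.exp_neg, one_div]
        apply inv_anti₀ (by norm_num)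
        linarith [Real.add_one_le_exp (2 : ℝ)]

theorem hyperProb_exists_high_degree_le (hp0 : 0 ≤ p) (hp1 : p ≤ 1) (hn : 0 < n) (hk : 3 ≤ k)
    (hpD : p * n.choose k ≤ D * n) (hD : 80 ≤ D) {K s : ℕ} (hK : (K : ℝ) = 160 * k ^ 2 * D)
    (hs0 : 0 < s) (hsk : k * s ≤ n) (hs : n * Real.exp (-(k * D)) ≤ s) :
    HG.hyperProb n k p (fun E => ∃ S ∈ (Finset.univ : Finset (Fin n)).powersetCard s,
      ∀ v ∈ S, K < 4 * (k * #{e ∈ E | v ∈ e})) ≤ Real.exp (-Real.log n) := by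
  have hnR : (0 : ℝ) < n := by exact_mod_cast hn
  have hkR : (3 : ℝ) ≤ k := by exact_mod_cast hk
  have hsR : (1 : ℝ) ≤ s := by exact_mod_cast hs0
  set d := k * D with hd
  have hd1 : 1 ≤ d := by nlinarith
  have hlog : Real.log n ≤ s * d := by
    have h1 : Real.exp (Real.log n - d) ≤ s := by
      rwa [sub_eq_add_neg, Real.exp_add, Real.exp_log hnR]
    have h2 := Real.add_one_le_exp (Real.log n - d)
    nlinarith
  calc _ ≤ ∑ S ∈ (Finset.univ : Finset (Fin n)).powersetCard s, HG.hyperProb n k p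
          (fun E => ∀ v ∈ S, K < 4 * (k * #{e ∈ E | v ∈ e})) := hyperProb_exists_le hp0 hp1 _ _
    _ ≤ ∑ S ∈ (Finset.univ : Finset (Fin n)).powersetCard s,
          Real.exp (2 * k * D * s - s * (K / (8 * k))) := by
        refine sum_le_sum fun S hS => ?_
        have hSs := (mem_powersetCard.1 hS).2
        have := hyperProb_high_degree_le hp0 hp1 hn (by omega) hpD S (by rwa [hSs]) K
        rwa [hSs] at this
    _ = n.choose s * Real.exp (s * (2 * d - 20 * d)) := by
        rw [sum_const, card_powersetCard, card_univ, Fintype.card_fin, nsmul_eq_mul, hK]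
        congr 2
        field_simp
        ring
    _ ≤ (Real.exp s * Real.exp d ^ s) * Real.exp (s * (2 * d - 20 * d)) := by
        refine mul_le_mul_of_nonneg_right ((choose_le_exp_mul_pow n hs0).trans ?_)
          (Real.exp_pos _).le
        gcongr
        rw [div_le_iff₀ (by linarith)]
        rw [Real.exp_neg, ← div_eq_mul_inv, div_le_iff₀ (Real.exp_pos _)] at hs
        linarith
    _ = Real.exp (s + s * d + s * (2 * d - 20 * d)) := by
        rw [← Real.exp_nat_mul, Real.exp_add, Real.exp_add]
    _ ≤ Real.exp (-Real.log n) := by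
        apply Real.exp_le_exp.2
        nlinarith

theorem one_sub_le_hyperProb_rColorable {r : ℕ} (hp0 : 0 ≤ p) (hp1 : p ≤ 1) (hn : 0 < n)
    (hk : 3 ≤ k) (hr : 2 ≤ r) (hkn : 2 * k ≤ n) (hpD : p * n.choose k ≤ D * n) (hD : 80 ≤ D)
    (hrD : (r : ℝ) ^ (k - 1) = 160 * k ^ 2 * D) :
    1 - (Real.exp (-Real.log n) + Real.exp (-(Real.log n / 4)) * 2) ≤
      HG.hyperProb n k p (HG.RColorable r) := by
  have hnR : (0 : ℝ) < n := by exact_mod_cast hn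
  have hkR : (3 : ℝ) ≤ k := by exact_mod_cast hk
  set t : ℝ := n * Real.exp (-(k * D)) with ht
  set s := ⌊t⌋₊ with hs
  have ht0 : 0 ≤ t := by positivity
  have hst : (s : ℝ) ≤ t := Nat.floor_le ht0
  have hts : t ≤ (s + 1 : ℕ) := by
    push_cast
    exact (Nat.lt_floor_add_one t).le
  have hks : k * (s + 1) ≤ n := by
    have h1 : k * Real.exp (-(k * D)) ≤ 1 / 2 := by
      rw [Real.exp_neg, ← div_eq_mul_inv, div_le_iff₀ (Real.exp_pos _)]
      have := Real.add_one_le_exp (k * D)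
      nlinarith
    have h2 : (k : ℝ) * s ≤ n / 2 := by
      calc (k : ℝ) * s ≤ k * t := by gcongr
        _ = n * (k * Real.exp (-(k * D))) := by rw [ht]; ring
        _ ≤ n * (1 / 2) := by gcongr
        _ = n / 2 := by ring
    have h3 : (2 : ℝ) * k ≤ n := by exact_mod_cast hkn
    have h4 : (k : ℝ) * (s + 1) ≤ n := by linarith
    exact_mod_cast h4
  have hhigh := hyperProb_exists_high_degree_le hp0 hp1 hn hk hpD hD (K := r ^ (k - 1))
    (by exact_mod_cast hrD) (Nat.succ_pos s) hks hts
  have hdense : HG.hyperProb n k p (fun E => ∃ j ∈ Finset.Icc k (3 * k * s),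
      ∃ S ∈ (Finset.univ : Finset (Fin n)).powersetCard j,
        2 * #S ≤ (2 * k - 3) * #{e ∈ E | e ⊆ S}) ≤ Real.exp (-(Real.log n / 4)) * 2 := by
    refine (hyperProb_exists_le hp0 hp1 _ _).trans ?_
    calc _ ≤ ∑ j ∈ Finset.Icc k (3 * k * s), Real.exp (-(Real.log n / 4)) * (1 / 2) ^ j := by
          refine sum_le_sum fun j hj => ?_
          obtain ⟨hkj, hjs⟩ := Finset.mem_Icc.1 hj
          refine hyperProb_exists_dense_le hp0 hp1 hn hk hpD hD hkj ?_ ?_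
          · have hs1 : 1 ≤ s := by
              by_contra! h0
              have : s = 0 := by omega
              rw [this] at hjs
              omega
            have ht1 : 1 ≤ t := le_trans (by exact_mod_cast hs1) hst
            rw [Real.le_log_iff_exp_le hnR]
            rwa [ht, Real.exp_neg, ← div_eq_mul_inv, one_le_div (Real.exp_pos _)] at ht1
          · calc (j : ℝ) ≤ 3 * k * s := by exact_mod_cast hjs
              _ ≤ 3 * k * t := by gcongr
      _ ≤ ∑ j ∈ range (3 * k * s + 1), Real.exp (-(Real.log n / 4)) * (1 / 2) ^ j := by
          refine sum_le_sum_of_subset_of_nonneg (fun j hj => ?_) fun j _ _ => by positivity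
          rw [Finset.mem_Icc] at hj
          exact mem_range.2 (by omega)
      _ ≤ _ := by
          rw [← mul_sum]
          gcongr
          exact sum_geometric_two_le _
  have hbad : HG.hyperProb n k p (fun E => ¬ HG.RColorable r E) ≤
      Real.exp (-Real.log n) + Real.exp (-(Real.log n / 4)) * 2 := by
    refine le_trans ?_ (add_le_add hhigh hdense)
    refine le_trans ?_ (hyperProb_or_le hp0 hp1 _ _)
    refine hyperProb_mono hp0 hp1 fun E hE hcol => ?_
    by_contra hcon
    push Not at hcon
    obtain ⟨hlow, hsparse⟩ := hcon
    refine hcol (rColorable_of_sparse hr hk E hE s ?_ fun S hS hSs => ?_)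
    · by_contra! hlt
      obtain ⟨S, hSsub, hScard⟩ := exists_subset_card_eq (Nat.succ_le_of_lt hlt)
      obtain ⟨v, hv, hvd⟩ := hlow S (mem_powersetCard.2 ⟨subset_univ _, hScard⟩)
      refine absurd (mem_filter.1 (hSsub hv)).2 ?_
      convert not_lt.2 hvd
      rfl
    · by_cases hkS : k ≤ #S
      · convert hsparse #S (Finset.mem_Icc.2 ⟨hkS, hSs⟩) S
          (mem_powersetCard.2 ⟨subset_univ _, rfl⟩)
        rfl
      · have hempty : E.filter (fun e => e ⊆ S) = ∅ := by
          rw [filter_eq_empty_iff]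
          intro e he heS
          exact hkS ((hE e he).symm.le.trans (card_le_card heS))
        have hlt : (2 * k - 3) * #{e ∈ E | e ⊆ S} < 2 * #S := by
          rw [hempty, card_empty, mul_zero]
          have := card_pos.2 hS
          omega
        convert hlt
  have := hyperProb_add_not (n := n) (k := k) (p := p) (HG.RColorable r)
  linarith

end UnionBounds

theorem pow_three_le_two_pow {k : ℕ} (hk : 3 ≤ k) : k ^ 3 ≤ 8 * 2 ^ (k - 1) := by
  obtain ⟨m, rfl⟩ : ∃ m, k = m + 3 := ⟨k - 3, by omega⟩
  rw [show m + 3 - 1 = m + 2 by omega]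
  rcases Nat.lt_or_ge m 2 with hm | hm
  · interval_cases m <;> norm_num
  · clear hk
    induction m, hm using Nat.le_induction with
    | base => norm_num
    | succ m hm ih =>
      rw [show m + 1 + 2 = (m + 2) + 1 by ring, pow_succ 2]
      have : (m + 1 + 3) ^ 3 ≤ 2 * (m + 3) ^ 3 := by
        obtain ⟨t, rfl⟩ := Nat.exists_eq_add_of_le hm
        nlinarith [Nat.zero_le (t ^ 3), Nat.zero_le (t ^ 2)]
      linarith
theorem rColorable_bound {n k r : ℕ} {p : ℝ} (hk : 3 ≤ k) (hr : 2 ≤ r)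
    (hC : (10 : ℝ) ^ 10 ≤ (r : ℝ) ^ (k - 1) / k) (hrn : (r : ℝ) ^ (k - 1) ≤ 1 / 8 * n)
    (hp0 : 0 ≤ p)
    (hp : p ≤ 1 / 160 * ((r : ℝ) ^ (k - 1) / (k : ℝ) ^ 2) * ((n : ℝ) / n.choose k)) :
    p ≤ 1 ∧ 1 - (Real.exp (-Real.log n) + Real.exp (-(Real.log n / 4)) * 2) ≤
      HG.hyperProb n k p (HG.RColorable r) := by
  have hkR : (3 : ℝ) ≤ k := by exact_mod_cast hk
  set K : ℝ := (r : ℝ) ^ (k - 1) with hK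
  set D : ℝ := 1 / 160 * (K / (k : ℝ) ^ 2) with hDdef
  have hK3 : (k : ℝ) ^ 3 ≤ 8 * K := by
    calc (k : ℝ) ^ 3 ≤ 8 * 2 ^ (k - 1) := by exact_mod_cast pow_three_le_two_pow hk
      _ ≤ 8 * K := by
        rw [hK]
        gcongr
        exact_mod_cast hr
  have hK0 : 0 < K := by
    have : (0 : ℝ) < (k : ℝ) ^ 3 := by positivity
    linarith
  have hD : 80 ≤ D := by
    rw [le_div_iff₀ (by positivity)] at hC
    have h1 : (12800 * (k : ℝ) ^ 2) ^ 2 ≤ K ^ 2 := by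
      have : 10 ^ 10 * (k : ℝ) * k ^ 3 ≤ K * (8 * K) := by gcongr
      nlinarith [pow_pos (by linarith : (0 : ℝ) < k) 4]
    have h2 : 12800 * (k : ℝ) ^ 2 ≤ K := le_of_sq_le_sq h1 hK0.le
    have h3 : 12800 ≤ K / (k : ℝ) ^ 2 := by
      rwa [le_div_iff₀ (by positivity)]
    rw [hDdef]
    linarith
  have hkn3 : (k : ℝ) ^ 3 ≤ n := by linarith
  have hkn2 : 2 * k ≤ n := by
    have : k ^ 3 ≤ n := by exact_mod_cast hkn3
    nlinarith [sq_nonneg (k - 3), Nat.pow_le_pow_left hk 2]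
  have hn : 0 < n := by omega
  have hnR : (0 : ℝ) < n := by exact_mod_cast hn
  have hch : (0 : ℝ) < n.choose k := by exact_mod_cast Nat.choose_pos (by omega)
  have hpD : p * n.choose k ≤ D * n := by
    rwa [← le_div_iff₀ hch, mul_div_assoc]
  have hp1 : p ≤ 1 := by
    have hDn : D ≤ n := by
      have h1 : K / (k : ℝ) ^ 2 ≤ K := div_le_self hK0.le (by nlinarith)
      rw [hDdef]
      linarith
    have h1 : (n : ℝ) ^ 2 ≤ n.choose k := by
      calc (n : ℝ) ^ 2 ≤ ((n : ℝ) / k) ^ 3 := by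
            rw [div_pow, le_div_iff₀ (by positivity), pow_succ (n : ℝ) 2]
            gcongr
        _ ≤ ((n : ℝ) / k) ^ k := by
            refine pow_le_pow_right₀ ?_ hk
            rw [one_le_div (by linarith)]
            exact_mod_cast (by omega : k ≤ n)
        _ ≤ n.choose k := by
            have h := choose_le_choose_mul_div_pow hn (by omega : k ≤ n) k
            rw [Nat.choose_self, Nat.cast_one, div_pow, mul_div_assoc',
              le_div_iff₀ (by positivity), one_mul] at h
            rw [div_pow, div_le_iff₀ (by positivity)]
            exact h
    have h2 : D * n ≤ n.choose k := by nlinarith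
    by_contra! h
    nlinarith
  refine ⟨hp1, one_sub_le_hyperProb_rColorable hp0 hp1 hn hk hr hkn2 hpD hD ?_⟩
  rw [hDdef]
  field_simp
  exact hK.symm

/-- There exist positive constants `C` and `c` such that for any
functions `k = k(n) ≥ 3` and `r = r(n) ≥ 2` satisfying `r^(k-1)/k ≥ C` and
`r^(k-1) = o(n)`: if `p = p(n) ≤ c * (r^(k-1)/k^2) * n / C(n,k)`, then
`P(H(n,k,p) is r-colorable) → 1` as `n → ∞`. -/
theorem stmt0 :
    ∃ C c : ℝ, 0 < C ∧ 0 < c ∧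
      ∀ k r : ℕ → ℕ, ∀ p : ℕ → ℝ,
        (∀ n, 3 ≤ k n) → (∀ n, 2 ≤ r n) →
        (∀ n, C ≤ (r n : ℝ) ^ (k n - 1) / (k n : ℝ)) →
        ((fun n => (r n : ℝ) ^ (k n - 1)) =o[atTop] fun n => (n : ℝ)) →
        (∀ n, 0 ≤ p n) →
        (∀ n, p n ≤ c * ((r n : ℝ) ^ (k n - 1) / (k n : ℝ) ^ 2) *
            ((n : ℝ) / (n.choose (k n) : ℝ))) →
        Tendsto (fun n => HG.hyperProb n (k n) (p n) (HG.RColorable (r n)))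
          atTop (nhds 1) := by
  refine ⟨10 ^ 10, 1 / 160, by norm_num, by norm_num, ?_⟩
  intro k r p hk hr hC ho hp0 hp
  have hev : ∀ᶠ n in atTop, p n ≤ 1 ∧
      1 - (Real.exp (-Real.log n) + Real.exp (-(Real.log n / 4)) * 2) ≤
        HG.hyperProb n (k n) (p n) (HG.RColorable (r n)) := by
    filter_upwards [ho.def (by norm_num : (0 : ℝ) < 1 / 8)] with n hn
    rw [Real.norm_of_nonneg (by positivity), Real.norm_of_nonneg (by positivity)] at hn
    exact rColorable_bound (hk n) (hr n) (hC n) hn (hp0 n) (hp n)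
  have hlog : Tendsto (fun n : ℕ => Real.log n) atTop atTop :=
    Real.tendsto_log_atTop.comp tendsto_natCast_atTop_atTop
  have h1 : Tendsto (fun n : ℕ => Real.exp (-Real.log n)) atTop (nhds 0) :=
    Real.tendsto_exp_neg_atTop_nhds_zero.comp hlog
  have h2 : Tendsto (fun n : ℕ => Real.exp (-(Real.log n / 4))) atTop (nhds 0) :=
    Real.tendsto_exp_neg_atTop_nhds_zero.comp (hlog.atTop_div_const (by norm_num))
  have hlim : Tendsto (fun n : ℕ =>
      1 - (Real.exp (-Real.log n) + Real.exp (-(Real.log n / 4)) * 2)) atTop (nhds 1) := by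
    simpa using (tendsto_const_nhds (x := (1 : ℝ))).sub (h1.add (h2.mul_const 2))
  refine tendsto_of_tendsto_of_tendsto_of_le_of_le' hlim tendsto_const_nhds
    (hev.mono fun n hn => hn.2) (hev.mono fun n hn => ?_)
  have := hyperProb_add_not (n := n) (k := k n) (p := p n) (HG.RColorable (r n))
  have := hyperProb_nonneg (n := n) (k := k n) (hp0 n) hn.1 fun E => ¬ HG.RColorable (r n) E
  linarith
end

section
/- Let k = k(n) and r = r(n) ≥ 2 satisfy k²r = o(n). Then for any fixed ε > 0: if p = p(n) ≥ (1+ε) · r^{k-1} ln r · n/C(n,k), then P(H(n,k,p) is r-colorable) → 0 as n → ∞. -/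
open Finset Filter

open scoped Classical

namespace HG

lemma sum_choose_le_card_monochromatic {n r : ℕ} (j : ℕ) (c : Fin n → Fin r) :
    ∑ i, (#{v | c v = i}).choose (j + 1) ≤
      #{e ∈ (Finset.univ : Finset (Fin n)).powersetCard (j + 1) | Monochromatic c e} := by
  have hdisj : ((Finset.univ : Finset (Fin r)) : Set (Fin r)).PairwiseDisjoint
      fun i => (Finset.univ.filter fun v => c v = i).powersetCard (j + 1) := by
    intro a _ b _ hab
    refine Finset.disjoint_left.2 fun e ha hb => hab ?_
    rw [Finset.mem_powersetCard] at ha hb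
    obtain ⟨v, hv⟩ : e.Nonempty := Finset.card_pos.1 (by omega)
    have h1 := ha.1 hv
    have h2 := hb.1 hv
    simp only [Finset.mem_filter, Finset.mem_univ, true_and] at h1 h2
    exact h1.symm.trans h2
  simp_rw [← Finset.card_powersetCard]
  rw [← Finset.card_biUnion hdisj]
  refine Finset.card_le_card fun e he => ?_
  simp only [Finset.mem_biUnion, Finset.mem_univ, true_and, Finset.mem_powersetCard] at he
  obtain ⟨i, hi, hc⟩ := he
  simp only [Finset.mem_filter, Finset.mem_powersetCard]
  refine ⟨⟨Finset.subset_univ _, hc⟩, fun v hv w hw => ?_⟩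
  have h1 := hi hv
  have h2 := hi hw
  simp only [Finset.mem_filter, Finset.mem_univ, true_and] at h1 h2
  exact h1.trans h2.symm

lemma choose_mul_le_pow_mul_sum_choose {n r j : ℕ} (hn : 0 < n) (hr : 0 < r)
    (hrn : r * (j + 1) ≤ n) (m : Fin r → ℕ) (hm : ∑ i, m i = n) :
    (n.choose (j + 1) : ℝ) * (1 - r * (j + 1) ^ 2 / n) ≤
      r ^ j * ∑ i, ((m i).choose (j + 1) : ℝ) := by
  have hn' : (0 : ℝ) < n := by exact_mod_cast hn
  have hr' : (0 : ℝ) < r := by exact_mod_cast hr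
  have hrn' : (r : ℝ) * (j + 1) ≤ n := by exact_mod_cast hrn
  have hfac : (0 : ℝ) < (j + 1).factorial := by exact_mod_cast Nat.factorial_pos _
  have hq : (r : ℝ) * (j + 1) / n ≤ 1 := (div_le_one hn').2 hrn'
  have hbern : 1 - (r : ℝ) * (j + 1) ^ 2 / n ≤ (1 - r * (j + 1) / n) ^ (j + 1) := by
    have h := one_add_mul_le_pow (a := -((r : ℝ) * (j + 1) / n)) (by linarith) (j + 1)
    push_cast at h
    calc 1 - (r : ℝ) * (j + 1) ^ 2 / n = 1 + (j + 1) * -((r : ℝ) * (j + 1) / n) := by ring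
      _ ≤ _ := h
      _ = _ := by ring
  have hchoose : (n.choose (j + 1) : ℝ) * (j + 1).factorial ≤ n ^ (j + 1) := by
    have h := Nat.descFactorial_le_pow n (j + 1)
    rw [Nat.descFactorial_eq_factorial_mul_choose, mul_comm] at h
    exact_mod_cast h
  have hsum : (n : ℝ) - r * (j + 1) ≤ ∑ i, ((m i - j : ℕ) : ℝ) := by
    have h : ∑ i : Fin r, ((m i : ℝ) - j) ≤ ∑ i, ((m i - j : ℕ) : ℝ) := by
      refine Finset.sum_le_sum fun i _ => ?_
      rw [sub_le_iff_le_add]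
      exact_mod_cast (by omega : m i ≤ m i - j + j)
    have hm' : ∑ i, (m i : ℝ) = n := by exact_mod_cast hm
    rw [Finset.sum_sub_distrib, hm'] at h
    simp only [Finset.sum_const, Finset.card_univ, Fintype.card_fin, nsmul_eq_mul] at h
    linarith
  have hpow : (∑ i, ((m i - j : ℕ) : ℝ)) ^ (j + 1) ≤
      r ^ j * ∑ i, ((m i - j : ℕ) : ℝ) ^ (j + 1) := by
    have h := pow_sum_div_card_le_sum_pow (s := (Finset.univ : Finset (Fin r)))
      (f := fun i => ((m i - j : ℕ) : ℝ)) (fun i _ => Nat.cast_nonneg _) j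
    rw [Finset.card_univ, Fintype.card_fin, div_le_iff₀' (by positivity)] at h
    exact h
  have hdesc : ∑ i, ((m i - j : ℕ) : ℝ) ^ (j + 1) ≤
      (j + 1).factorial * ∑ i, ((m i).choose (j + 1) : ℝ) := by
    rw [Finset.mul_sum]
    refine Finset.sum_le_sum fun i _ => ?_
    have h := Nat.pow_sub_le_descFactorial (m i) (j + 1)
    rw [Nat.descFactorial_eq_factorial_mul_choose, Nat.add_sub_add_right] at h
    exact_mod_cast h
  have hbase : (n : ℝ) * (1 - r * (j + 1) / n) = n - r * (j + 1) := by
    field_simp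
  refine le_of_mul_le_mul_right ?_ hfac
  calc (n.choose (j + 1) : ℝ) * (1 - r * (j + 1) ^ 2 / n) * (j + 1).factorial
      = (n.choose (j + 1) : ℝ) * (j + 1).factorial * (1 - r * (j + 1) ^ 2 / n) := by ring
    _ ≤ (n.choose (j + 1) : ℝ) * (j + 1).factorial * (1 - r * (j + 1) / n) ^ (j + 1) := by
        gcongr
    _ ≤ n ^ (j + 1) * (1 - r * (j + 1) / n) ^ (j + 1) := by
        have : (0 : ℝ) ≤ (1 - r * (j + 1) / n) ^ (j + 1) := pow_nonneg (by linarith) _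
        gcongr
    _ = (n - r * (j + 1)) ^ (j + 1) := by rw [← mul_pow, hbase]
    _ ≤ (∑ i, ((m i - j : ℕ) : ℝ)) ^ (j + 1) :=
        pow_le_pow_left₀ (by linarith) hsum _
    _ ≤ r ^ j * ∑ i, ((m i - j : ℕ) : ℝ) ^ (j + 1) := hpow
    _ ≤ r ^ j * ((j + 1).factorial * ∑ i, ((m i).choose (j + 1) : ℝ)) := by gcongr
    _ = _ := by ring

lemma choose_mul_le_pow_mul_card_monochromatic {n r j : ℕ} (hn : 0 < n) (hr : 0 < r)
    (hrn : r * (j + 1) ≤ n) (c : Fin n → Fin r) :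
    (n.choose (j + 1) : ℝ) * (1 - r * (j + 1) ^ 2 / n) ≤ r ^ j *
      (#{e ∈ (Finset.univ : Finset (Fin n)).powersetCard (j + 1) | Monochromatic c e} : ℝ) := by
  have hm : ∑ i, #{v | c v = i} = n := by
    rw [← Finset.card_eq_sum_card_fiberwise (f := c) (fun _ _ => Finset.mem_coe.2 (mem_univ _)),
      Finset.card_univ, Fintype.card_fin]
  refine (choose_mul_le_pow_mul_sum_choose hn hr hrn _ hm).trans ?_
  have h := sum_choose_le_card_monochromatic j c
  gcongr
  exact_mod_cast h

lemma sum_powerset_avoiding {α : Type*} (S : Finset α) (Q : α → Prop) (p : ℝ) :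
    (∑ E ∈ S.powerset,
      if ∀ e ∈ E, ¬ Q e then p ^ E.card * (1 - p) ^ (S.card - E.card) else 0) =
      (1 - p) ^ #{e ∈ S | Q e} := by
  have hcard : #{e ∈ S | Q e} + #{e ∈ S | ¬ Q e} = #S :=
    Finset.card_filter_add_card_filter_not _
  have hset : (S.powerset.filter fun E => ∀ e ∈ E, ¬ Q e) =
      (S.filter fun e => ¬ Q e).powerset := by
    ext E
    simp only [Finset.mem_filter, Finset.mem_powerset, Finset.subset_iff]
    exact ⟨fun h e he => ⟨h.1 he, h.2 e he⟩, fun h => ⟨fun e he => (h he).1, fun e he => (h he).2⟩⟩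
  rw [← Finset.sum_filter, hset]
  have hterm : ∀ E ∈ (S.filter fun e => ¬ Q e).powerset,
      p ^ E.card * (1 - p) ^ (S.card - E.card) = (1 - p) ^ #{e ∈ S | Q e} *
        (p ^ E.card * (1 - p) ^ (#{e ∈ S | ¬ Q e} - E.card)) := by
    intro E hE
    have hle := Finset.card_le_card (Finset.mem_powerset.1 hE)
    rw [show S.card - E.card = #{e ∈ S | Q e} + (#{e ∈ S | ¬ Q e} - E.card) by omega, pow_add]
    ring
  rw [Finset.sum_congr rfl hterm, ← Finset.mul_sum, Finset.sum_pow_mul_eq_add_pow]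
  simp

lemma hyperProb_nonneg {n k : ℕ} {p : ℝ} (hp0 : 0 ≤ p) (hp1 : p ≤ 1)
    (P : Finset (Finset (Fin n)) → Prop) : 0 ≤ hyperProb n k p P := by
  have : 0 ≤ 1 - p := by linarith
  refine Finset.sum_nonneg fun E _ => ?_
  split_ifs <;> positivity

/-- Union bound over all colorings. -/
lemma hyperProb_rColorable_le {n k r : ℕ} {p : ℝ} (hp0 : 0 ≤ p) (hp1 : p ≤ 1) :
    hyperProb n k p (RColorable r) ≤ ∑ c : Fin n → Fin r,
      (1 - p) ^ #{e ∈ (Finset.univ : Finset (Fin n)).powersetCard k | Monochromatic c e} := by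
  have hq : 0 ≤ 1 - p := by linarith
  simp_rw [← sum_powerset_avoiding]
  rw [Finset.sum_comm]
  refine Finset.sum_le_sum fun E _ => ?_
  by_cases h : RColorable r E
  · obtain ⟨c, hc⟩ := h
    rw [if_pos ⟨c, hc⟩]
    refine le_trans (le_of_eq ?_) (Finset.single_le_sum (fun c _ => ?_) (Finset.mem_univ c))
    · rw [if_pos hc]
    · split_ifs <;> positivity
  · rw [if_neg h]
    refine Finset.sum_nonneg fun c _ => ?_
    split_ifs <;> positivity

lemma hyperProb_rColorable_le_exp {n r j : ℕ} {p ε : ℝ} (hn : 0 < n) (hr : 2 ≤ r) (hε : 0 < ε)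
    (hp1 : p ≤ 1) (hsmall : ((j + 1 : ℕ) : ℝ) ^ 2 * r ≤ ε / (2 * (1 + ε)) * n)
    (hp : (1 + ε) * (r : ℝ) ^ j * Real.log r * (n / (n.choose (j + 1) : ℝ)) ≤ p) :
    0 ≤ p ∧ hyperProb n (j + 1) p (RColorable r) ≤ Real.exp (-(ε / 2 * Real.log 2 * n)) := by
  have hn' : (0 : ℝ) < n := by exact_mod_cast hn
  have hr' : (2 : ℝ) ≤ r := by exact_mod_cast hr
  have hr0 : (0 : ℝ) < r := by linarith
  have hlog2 : 0 < Real.log 2 := Real.log_pos (by norm_num)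
  have hlog : Real.log 2 ≤ Real.log r := Real.log_le_log (by norm_num) hr'
  have hlog0 : 0 < Real.log r := hlog2.trans_le hlog
  have hp0 : 0 ≤ p := le_trans (by positivity) hp
  refine ⟨hp0, ?_⟩
  push_cast at hsmall
  have hδ1 : ε / (2 * (1 + ε)) ≤ 1 := by
    rw [div_le_one (by positivity)]
    linarith
  have hrn' : (r : ℝ) * (j + 1) ≤ n := by
    have h1 : (0 : ℝ) ≤ j := Nat.cast_nonneg j
    calc (r : ℝ) * (j + 1) ≤ r * (j + 1) ^ 2 := by gcongr; nlinarith
      _ = (j + 1) ^ 2 * r := mul_comm _ _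
      _ ≤ _ := hsmall
      _ ≤ 1 * n := by gcongr
      _ = n := one_mul _
  have hrn : r * (j + 1) ≤ n := by exact_mod_cast hrn'
  have hC : (0 : ℝ) < n.choose (j + 1) := by
    have : j + 1 ≤ n := le_trans (Nat.le_mul_of_pos_left _ (by omega)) hrn
    exact_mod_cast Nat.choose_pos this
  have hfrac : ε / (2 * (1 + ε)) * n / n = ε / (2 * (1 + ε)) := by field_simp
  have hδ : 1 - ε / (2 * (1 + ε)) ≤ 1 - (r : ℝ) * (j + 1) ^ 2 / n := by
    rw [← hfrac, mul_comm (r : ℝ)]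
    gcongr
  have hterm : ∀ c : Fin n → Fin r,
      (1 - p) ^ #{e ∈ (Finset.univ : Finset (Fin n)).powersetCard (j + 1) | Monochromatic c e} ≤
        Real.exp (-((1 + ε / 2) * Real.log r * n)) := by
    intro c
    have hcount := choose_mul_le_pow_mul_card_monochromatic hn (by omega) hrn c
    set M := #{e ∈ (Finset.univ : Finset (Fin n)).powersetCard (j + 1) | Monochromatic c e}
    have hcount' : (n.choose (j + 1) : ℝ) * (1 - ε / (2 * (1 + ε))) ≤ r ^ j * M :=
      le_trans (by gcongr) hcount
    have hpM : (1 + ε / 2) * Real.log r * n ≤ p * M := by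
      calc (1 + ε / 2) * Real.log r * n
          = (1 + ε) * Real.log r * (n / (n.choose (j + 1) : ℝ)) *
            ((n.choose (j + 1) : ℝ) * (1 - ε / (2 * (1 + ε)))) := by
            field_simp
            ring
        _ ≤ (1 + ε) * Real.log r * (n / (n.choose (j + 1) : ℝ)) * (r ^ j * M) := by gcongr
        _ = (1 + ε) * (r : ℝ) ^ j * Real.log r * (n / (n.choose (j + 1) : ℝ)) * M := by ring
        _ ≤ p * M := by gcongr
    calc (1 - p) ^ M ≤ Real.exp (-p) ^ M :=
          pow_le_pow_left₀ (by linarith) (Real.one_sub_le_exp_neg p) _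
      _ = Real.exp (-(p * M)) := by rw [← Real.exp_nat_mul]; ring_nf
      _ ≤ _ := Real.exp_le_exp.2 (neg_le_neg hpM)
  calc hyperProb n (j + 1) p (RColorable r)
      ≤ _ := hyperProb_rColorable_le hp0 hp1
    _ ≤ ∑ _c : Fin n → Fin r, Real.exp (-((1 + ε / 2) * Real.log r * n)) :=
        Finset.sum_le_sum fun c _ => hterm c
    _ = Real.exp (n * Real.log r) * Real.exp (-((1 + ε / 2) * Real.log r * n)) := by
        rw [Real.exp_nat_mul, Real.exp_log hr0]
        simp
    _ = Real.exp (-(ε / 2 * Real.log r * n)) := by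
        rw [← Real.exp_add]
        ring_nf
    _ ≤ Real.exp (-(ε / 2 * Real.log 2 * n)) := by gcongr

end HG

/-- If `k = k(n)` and `r = r(n) ≥ 2` satisfy `k^2 r = o(n)`, then for
any fixed `ε > 0`: if `p = p(n) ≥ (1+ε) r^(k-1) (ln r) n / C(n,k)`, then
`P(H(n,k,p) is r-colorable) → 0` as `n → ∞`. -/
theorem stmt1 (k r : ℕ → ℕ) (p : ℕ → ℝ)
    (hr : ∀ n, 2 ≤ r n)
    (ho : (fun n => ((k n : ℝ) ^ 2 * (r n : ℝ))) =o[atTop] fun n => (n : ℝ))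
    (ε : ℝ) (hε : 0 < ε)
    (hp1 : ∀ n, p n ≤ 1)
    (hp : ∀ n, (1 + ε) * (r n : ℝ) ^ (k n - 1) * Real.log (r n) *
        ((n : ℝ) / (n.choose (k n) : ℝ)) ≤ p n) :
    Tendsto (fun n => HG.hyperProb n (k n) (p n) (HG.RColorable (r n)))
      atTop (nhds 0) := by
  have hlog2 : 0 < Real.log 2 := Real.log_pos (by norm_num)
  have hlim : Tendsto (fun n : ℕ => Real.exp (-(ε / 2 * Real.log 2 * n))) atTop (nhds 0) :=
    Real.tendsto_exp_neg_atTop_nhds_zero.comp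
      (tendsto_natCast_atTop_atTop.const_mul_atTop (by positivity))
  have hbound : ∀ᶠ n in atTop, 0 ≤ p n ∧ HG.hyperProb n (k n) (p n) (HG.RColorable (r n)) ≤
      Real.exp (-(ε / 2 * Real.log 2 * n)) := by
    filter_upwards [ho.bound (show 0 < ε / (2 * (1 + ε)) by positivity), eventually_ge_atTop 1,
      (tendsto_natCast_atTop_atTop (R := ℝ)).eventually_gt_atTop (1 / Real.log 2)]
      with n hsmall hn hlarge
    rw [Real.norm_of_nonneg (by positivity), Real.norm_of_nonneg (by positivity)] at hsmall
    have hpn := hp n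
    rcases hk : k n with _ | j
    · exfalso
      rw [hk] at hpn
      have hlog : Real.log 2 ≤ Real.log (r n) :=
        Real.log_le_log (by norm_num) (by exact_mod_cast hr n)
      rw [div_lt_iff₀ hlog2] at hlarge
      simp only [zero_tsub, pow_zero, mul_one, Nat.choose_zero_right, Nat.cast_one, div_one] at hpn
      have h1 : (n : ℝ) * Real.log 2 ≤ (1 + ε) * Real.log (r n) * n := by
        calc (n : ℝ) * Real.log 2 = 1 * Real.log 2 * n := by ring
          _ ≤ _ := by gcongr; linarith
      linarith [hp1 n]
    · rw [hk] at hpn hsmall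
      exact HG.hyperProb_rColorable_le_exp hn (hr n) hε (hp1 n) hsmall hpn
  refine squeeze_zero' ?_ ?_ hlim
  · filter_upwards [hbound] with n hn
    exact HG.hyperProb_nonneg hn.1 (hp1 n) _
  · filter_upwards [hbound] with n hn
    exact hn.2
end
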